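/- arXiv:2307.09599 — 5 statements merged into one kernel-verified Lean document; each statement's English description precedes it below -/
import Mathlib

section
/- For every r > 0, F₀(r) = Σ_{i=0}^{[n/2]} (α_{2i}/(2π)) · a_{2i} · r^{2i+1} + Σ_{j=0}^{[m/2]} (2 b_{2j}/(π(2j+1))) · r^{2j}, where α_{2i} denotes the integral over [0, 2π] of (cos θ)^{2i} · (sin θ)^2 dθ; that is, the averaged function F₀ is a polynomial in r having at most [n/2] + [m/2] + 2 nonzero monomial terms, the f-part contributing only odd powers of r and the g-part contributing only even powers of r. -/
open Real intervalIntegral Finset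

theorem sum_range_eq_sum_even {M : Type*} [AddCommMonoid M] (f : ℕ → M)
    (hf : ∀ k, f (2 * k + 1) = 0) (n : ℕ) :
    ∑ i ∈ Finset.range (n + 1), f i = ∑ i ∈ Finset.range (n / 2 + 1), f (2 * i) := by
  have even_case : ∀ k, ∑ i ∈ Finset.range (2 * k + 1), f i =
      ∑ i ∈ Finset.range (k + 1), f (2 * i) := by
    intro k
    induction k with
    | zero => simp
    | succ k ih =>
      rw [Finset.sum_range_succ _ (k + 1), ← ih, mul_add_one, Finset.sum_range_succ,
        Finset.sum_range_succ, hf, add_zero]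
  obtain ⟨k, rfl | rfl⟩ := Nat.even_or_odd' n
  · rw [even_case, Nat.mul_div_cancel_left k two_pos]
  · rw [Finset.sum_range_succ, hf, add_zero, even_case]
    congr 2
    lia

theorem sign_mul_self_eq_abs (x : ℝ) : Real.sign x * x = |x| := by
  rcases lt_trichotomy x 0 with hx | rfl | hx
  · simp [Real.sign_of_neg hx, abs_of_neg hx]
  · simp
  · simp [Real.sign_of_pos hx, abs_of_pos hx]

theorem integral_cos_pow_odd_mul_sin_sq (k : ℕ) :
    ∫ θ in (0:ℝ)..(2 * π), Real.cos θ ^ (2 * k + 1) * Real.sin θ ^ 2 = 0 := by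
  simp_rw [mul_comm (Real.cos _ ^ _)]
  simp [integral_sin_pow_mul_cos_pow_odd]

theorem integral_sin_mul_cos_pow (x y : ℝ) (j : ℕ) :
    ∫ θ in x..y, Real.sin θ * Real.cos θ ^ j =
      (Real.cos x ^ (j + 1) - Real.cos y ^ (j + 1)) / (j + 1) := by
  simpa using integral_sin_pow_odd_mul_cos_pow (a := x) (b := y) 0 j

theorem integral_abs_sin_mul_cos_pow (j : ℕ) :
    ∫ θ in (0:ℝ)..(2 * π), |Real.sin θ| * Real.cos θ ^ j = 2 * (1 + (-1) ^ j) / (j + 1) := by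
  have integrable (x y : ℝ) :
      IntervalIntegrable (fun θ ↦ |Real.sin θ| * Real.cos θ ^ j) MeasureTheory.volume x y :=
    Continuous.intervalIntegrable (by fun_prop) x y
  have upper : ∫ θ in (0:ℝ)..π, |Real.sin θ| * Real.cos θ ^ j =
      ∫ θ in (0:ℝ)..π, Real.sin θ * Real.cos θ ^ j := by
    refine integral_congr fun θ hθ ↦ ?_
    rw [Set.uIcc_of_le pi_pos.le] at hθ
    simp only [abs_of_nonneg (Real.sin_nonneg_of_mem_Icc hθ)]
  have lower : ∫ θ in π..(2 * π), |Real.sin θ| * Real.cos θ ^ j =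
      ∫ θ in π..(2 * π), -(Real.sin θ * Real.cos θ ^ j) := by
    refine integral_congr fun θ hθ ↦ ?_
    rw [Set.uIcc_of_le (by linarith [pi_pos])] at hθ
    have hsin : Real.sin θ ≤ 0 := by
      rw [← Real.sin_sub_two_pi]
      exact Real.sin_nonpos_of_nonpos_of_neg_pi_le (by linarith [hθ.2]) (by linarith [hθ.1])
    simp only [abs_of_nonpos hsin, neg_mul]
  rw [← integral_add_adjacent_intervals (integrable 0 π) (integrable π (2 * π)), upper, lower,
    intervalIntegral.integral_neg, integral_sin_mul_cos_pow, integral_sin_mul_cos_pow]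
  simp only [Real.cos_zero, Real.cos_pi, Real.cos_two_pi, one_pow, pow_succ]
  ring

theorem averaged_function_formula (n m : ℕ) (a b : ℕ → ℝ) (r : ℝ) (hr : 0 < r) :
    (1 / (2 * π)) *
        ∫ θ in (0:ℝ)..(2 * π),
          ((∑ i ∈ Finset.range (n + 1), a i * (r * Real.cos θ) ^ i) * r * (Real.sin θ) ^ 2 +
            Real.sign (Real.sin θ) * Real.sin θ *
              ∑ j ∈ Finset.range (m + 1), b j * (r * Real.cos θ) ^ j) =
      (∑ i ∈ Finset.range (n / 2 + 1),
          ((∫ θ in (0:ℝ)..(2 * π), (Real.cos θ) ^ (2 * i) * (Real.sin θ) ^ 2) / (2 * π)) *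
            a (2 * i) * r ^ (2 * i + 1)) +
        ∑ j ∈ Finset.range (m / 2 + 1),
          (2 * b (2 * j) / (π * (2 * (j : ℝ) + 1))) * r ^ (2 * j) := by
  have integrand_eq (θ : ℝ) :
      (∑ i ∈ Finset.range (n + 1), a i * (r * Real.cos θ) ^ i) * r * Real.sin θ ^ 2 +
        Real.sign (Real.sin θ) * Real.sin θ *
          ∑ j ∈ Finset.range (m + 1), b j * (r * Real.cos θ) ^ j =
      (∑ i ∈ Finset.range (n + 1), a i * r ^ (i + 1) * (Real.cos θ ^ i * Real.sin θ ^ 2)) +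
        ∑ j ∈ Finset.range (m + 1), b j * r ^ j * (|Real.sin θ| * Real.cos θ ^ j) := by
    rw [sign_mul_self_eq_abs, Finset.sum_mul, Finset.sum_mul, Finset.mul_sum]
    congr 1 <;> exact Finset.sum_congr rfl fun i _ ↦ by ring
  simp_rw [integrand_eq]
  rw [intervalIntegral.integral_add (Continuous.intervalIntegrable (by fun_prop) _ _)
      (Continuous.intervalIntegrable (by fun_prop) _ _),
    intervalIntegral.integral_finsetSum
      fun i _ ↦ Continuous.intervalIntegrable (by fun_prop) _ _,
    intervalIntegral.integral_finsetSum
      fun j _ ↦ Continuous.intervalIntegrable (by fun_prop) _ _]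
  simp_rw [intervalIntegral.integral_const_mul, integral_abs_sin_mul_cos_pow]
  rw [sum_range_eq_sum_even _ (fun k ↦ by rw [integral_cos_pow_odd_mul_sin_sq, mul_zero]) n,
    sum_range_eq_sum_even _ (fun k ↦ by simp [pow_succ]) m, mul_add, Finset.mul_sum,
    Finset.mul_sum]
  congr 1
  · exact Finset.sum_congr rfl fun i _ ↦ by ring
  · refine Finset.sum_congr rfl fun j _ ↦ ?_
    rw [pow_mul (-1 : ℝ), neg_one_sq, one_pow]
    push_cast
    field_simp
    ring
end

section
/- For all natural numbers N and M, there exist real numbers c_0,…,c_N and d_0,…,d_M with d_0 ≠ 0 such that the polynomial P(r) = Σ_{i=0}^{N} c_i r^{2i+1} + Σ_{j=0}^{M} d_j r^{2j} has exactly N + M + 1 distinct positive real roots. -/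
open Finset

open Polynomial in
theorem Polynomial.signVariations_le_card_support_sub_one (P : ℝ[X]) :
    P.signVariations ≤ #P.support - 1 := by
  induction h : #P.support generalizing P with
  | zero =>
    have hP : P = 0 := by simpa using h
    simp [hP]
  | succ n ih =>
    have he := card_support_eraseLead' h
    rcases n with _ | n
    · obtain ⟨k, x, -, rfl⟩ := card_support_eq_one.mp h
      simp [C_mul_X_pow_eq_monomial]
    · have := ih _ he
      have := signVariations_le_eraseLead_succ P
      omega

open Polynomial in
/-- A nonzero real polynomial has fewer positive roots than monomials. -/
theorem Polynomial.card_lt_card_support_of_pos_roots {P : ℝ[X]} (hP : P ≠ 0) (S : Finset ℝ)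
    (hS : ∀ r ∈ S, 0 < r ∧ P.eval r = 0) : #S < #P.support := by
  have hpos : 0 < #P.support := by
    rw [card_pos, nonempty_support_iff]
    exact hP
  have hle : S.val ≤ P.roots.filter (0 < ·) := by
    rw [Multiset.le_iff_subset S.nodup]
    intro r hr
    have hr' := hS r hr
    simp [hP, hr'.1, hr'.2]
  have h1 := Multiset.card_le_card hle
  rw [← Multiset.countP_eq_card_filter] at h1
  have h2 := roots_countP_pos_le_signVariations P
  have h3 := P.signVariations_le_card_support_sub_one
  have h4 : #S = Multiset.card S.val := rfl
  omega

open Polynomial in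
/-- Interpolation with prescribed exponents `A` and prescribed roots `S`. -/
theorem Polynomial.exists_ne_zero_support_subset_eval_eq_zero (A : Finset ℕ) (S : Finset ℝ)
    (h : #S < #A) : ∃ P : ℝ[X], P ≠ 0 ∧ P.support ⊆ A ∧ ∀ r ∈ S, P.eval r = 0 := by
  let L : (A → ℝ) →ₗ[ℝ] (S → ℝ) :=
    Matrix.mulVecLin (Matrix.of fun (s : S) (a : A) => (s : ℝ) ^ (a : ℕ))
  have hL : LinearMap.ker L ≠ ⊥ := L.ker_ne_bot_of_finrank_lt (by simpa using h)
  obtain ⟨v, hv, hv0⟩ := Submodule.exists_mem_ne_zero_of_ne_bot hL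
  obtain ⟨a, ha⟩ := Function.ne_iff.mp hv0
  have hcoeff (n : ℕ) : (∑ a : A, monomial (a : ℕ) (v a)).coeff n =
      ∑ a : A, if (a : ℕ) = n then v a else 0 := by
    simp [coeff_monomial]
  refine ⟨∑ a : A, monomial (a : ℕ) (v a), fun h0 => ha ?_, fun n hn => ?_, fun r hr => ?_⟩
  · have := hcoeff a
    rw [h0] at this
    simpa [Subtype.coe_inj] using this.symm
  · by_contra hnA
    rw [mem_support_iff, hcoeff] at hn
    refine hn (Finset.sum_eq_zero fun b _ => if_neg ?_)
    rintro rfl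
    exact hnA b.2
  · have := congrFun (LinearMap.mem_ker.mp hv) ⟨r, hr⟩
    simpa [L, Matrix.mulVec, dotProduct, eval_finsetSum, mul_comm] using this

open Polynomial in
/-- Any `#A - 1` positive reals are exactly the positive roots of some polynomial whose set of
exponents is `A`. -/
theorem Polynomial.exists_support_eq_pos_roots_eq (A : Finset ℕ) (S : Finset ℝ)
    (h : #S + 1 = #A) (hS : ∀ r ∈ S, 0 < r) :
    ∃ P : ℝ[X], P.support = A ∧ ∀ r : ℝ, (0 < r ∧ P.eval r = 0) ↔ r ∈ S := by
  obtain ⟨P, hP, hsub, hroot⟩ := exists_ne_zero_support_subset_eval_eq_zero A S (by omega)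
  have hcard := card_lt_card_support_of_pos_roots hP S fun r hr => ⟨hS r hr, hroot r hr⟩
  have hsupp : P.support = A := eq_of_subset_of_card_le hsub (by omega)
  refine ⟨P, hsupp, fun r => ⟨fun hr => ?_, fun hr => ⟨hS r hr, hroot r hr⟩⟩⟩
  by_contra hrS
  have := card_lt_card_support_of_pos_roots hP (insert r S) fun x hx => by
    rcases mem_insert.mp hx with rfl | hx
    · exact hr
    · exact ⟨hS x hx, hroot x hx⟩
  rw [card_insert_of_notMem hrS, hsupp] at this
  omega

theorem odd_even_polynomial_positive_roots_sharp (N M : ℕ) :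
    ∃ (c d : ℕ → ℝ), d 0 ≠ 0 ∧
      ∃ S : Finset ℝ, S.card = N + M + 1 ∧
        ∀ r : ℝ, (0 < r ∧
          (∑ i ∈ Finset.range (N + 1), c i * r ^ (2 * i + 1)) +
            (∑ j ∈ Finset.range (M + 1), d j * r ^ (2 * j)) = 0) ↔ r ∈ S := by
  have hodd : Function.Injective fun i : ℕ => 2 * i + 1 := fun a b h => by grind
  have heven : Function.Injective fun j : ℕ => 2 * j := fun a b h => by grind
  have hdisj : Disjoint ((range (N + 1)).image fun i => 2 * i + 1)
      ((range (M + 1)).image fun j => 2 * j) := by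
    rw [disjoint_left]
    grind
  have hS : #((range (N + M + 1)).image fun k : ℕ => (k : ℝ) + 1) = N + M + 1 := by
    rw [card_image_of_injective _ fun a b h => by simpa using h, card_range]
  obtain ⟨P, hsupp, hP⟩ := Polynomial.exists_support_eq_pos_roots_eq
    ((range (N + 1)).image (fun i => 2 * i + 1) ∪ (range (M + 1)).image fun j => 2 * j)
    ((range (N + M + 1)).image fun k : ℕ => (k : ℝ) + 1)
    (by
      rw [hS, card_union_of_disjoint hdisj, card_image_of_injective _ hodd,
        card_image_of_injective _ heven, card_range, card_range]
      omega)
    (fun r hr => by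
      obtain ⟨k, -, rfl⟩ := mem_image.mp hr
      positivity)
  refine ⟨fun i => P.coeff (2 * i + 1), fun j => P.coeff (2 * j), ?_, _, hS, fun r => ?_⟩
  · rw [← Polynomial.mem_support_iff, hsupp]
    simp
  · rw [← hP r, Polynomial.eval_eq_sum, Polynomial.sum_def, hsupp, sum_union hdisj,
      sum_image hodd.injOn, sum_image heven.injOn]
end

section
/- Let p(x) = c_0 + Σ_{j=1}^{n} c_j x^{l_j} be a real polynomial, where 0 < l_1 < l_2 < … < l_n are natural numbers and c_0, c_1, …, c_n are all nonzero (so p has exactly n+1 monomial terms). If p has n distinct positive real roots, then the derivative p′ does not vanish at any positive real root of p; that is, every positive real root of p is a simple root. -/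
open Finset

theorem Polynomial.signVariations_succ_le_card_support {P : Polynomial ℝ} (hP : P ≠ 0) :
    P.signVariations + 1 ≤ #P.support := by
  induction h : #P.support using Nat.strong_induction_on generalizing P with
  | _ m ih =>
    have hlt := Polynomial.eraseLead_support_card_lt hP
    by_cases h0 : P.eraseLead = 0
    · have hpos : 0 < #P.support := by simpa [Finset.card_pos] using hP
      rw [← P.eraseLead_add_monomial_natDegree_leadingCoeff, h0, zero_add,
        Polynomial.signVariations_monomial]
      lia
    · have := ih _ (h ▸ hlt) h0 rfl
      have := P.signVariations_le_eraseLead_succ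
      lia

theorem Polynomial.card_le_signVariations_of_le_roots {P : Polynomial ℝ} {s : Multiset ℝ}
    (hs : s ≤ P.roots) (hpos : ∀ x ∈ s, 0 < x) : s.card ≤ P.signVariations := by
  rw [← Multiset.countP_eq_card.mpr hpos]
  exact (Multiset.countP_le_of_le _ hs).trans P.roots_countP_pos_le_signVariations

theorem max_positive_roots_imp_simple (n : ℕ) (c₀ : ℝ) (c : Fin n → ℝ) (l : Fin n → ℕ)
    (hl : StrictMono l) (hlpos : ∀ j, 0 < l j)
    (hc₀ : c₀ ≠ 0) (hc : ∀ j, c j ≠ 0)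
    (p : ℝ → ℝ) (hp : p = fun x => c₀ + ∑ j, c j * x ^ (l j))
    (hroots : ∃ S : Finset ℝ, S.card = n ∧ ∀ r ∈ S, 0 < r ∧ p r = 0) :
    ∀ a : ℝ, 0 < a → p a = 0 → deriv p a ≠ 0 := by
  obtain ⟨S, hS, hSr⟩ := hroots
  intro a ha hpa hda
  set P : Polynomial ℝ := .C c₀ + ∑ j, .monomial (l j) (c j) with hPdef
  have hpP : p = fun x => P.eval x := by
    funext x
    simp [hp, hPdef, Polynomial.eval_finsetSum]
  have hP : P ≠ 0 := by
    intro h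
    have h0 : P.coeff 0 = c₀ := by
      simp [hPdef, Polynomial.coeff_monomial, (hlpos _).ne']
    simp [h] at h0
    exact hc₀ h0.symm
  have hcard : #P.support ≤ n + 1 := by
    have hsub : P.support ⊆ insert 0 (univ.image l) := by
      intro k hk
      by_contra hk'
      simp only [mem_insert, mem_image, mem_univ, true_and, not_or, not_exists] at hk'
      simp [hPdef, Polynomial.coeff_monomial, Polynomial.coeff_C,
        hk'] at hk
    calc #P.support ≤ #(insert 0 (univ.image l)) := card_le_card hsub
      _ ≤ #(univ.image l) + 1 := card_insert_le _ _
      _ ≤ n + 1 := by simpa using card_image_le (s := univ) (f := l)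
  have hle : a ::ₘ S.val ≤ P.roots := by
    have hmult : 1 < P.rootMultiplicity a := by
      rw [Polynomial.one_lt_rootMultiplicity_iff_isRoot hP]
      refine ⟨by simpa [hpP] using hpa, ?_⟩
      simpa [hpP] using hda
    rw [Multiset.le_iff_count]
    intro b
    have hSb := Multiset.nodup_iff_count_le_one.mp S.nodup b
    rw [Multiset.count_cons, Polynomial.count_roots]
    split_ifs with hb
    · subst hb
      lia
    · by_cases hbS : b ∈ S
      · have : 0 < P.rootMultiplicity b :=
          (Polynomial.rootMultiplicity_pos hP).mpr (by simpa [hpP] using (hSr b hbS).2)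
        lia
      · simp [Multiset.count_eq_zero_of_notMem (show b ∉ S.val from hbS)]
  have h₁ := Polynomial.card_le_signVariations_of_le_roots hle (by
    simpa using ⟨ha, fun r hr => (hSr r hr).1⟩)
  have h₂ := Polynomial.signVariations_succ_le_card_support hP
  rw [Multiset.card_cons, card_val, hS] at h₁
  lia
end

section
/- (Descartes' rule of signs.) Let p(x) = a_{i_1} x^{i_1} + … + a_{i_r} x^{i_r} be a real polynomial with r > 1, exponents 0 ≤ i_1 < … < i_r, and coefficients a_{i_1}, …, a_{i_r} all nonzero. Let v be the number of indices j ∈ {1, …, r−1} with a_{i_j} · a_{i_{j+1}} < 0 (the number of sign variations). Then p has at most v distinct positive real roots. -/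
open Polynomial in
theorem leadingTerm_and_signVariations_sum_monomial (n : ℕ) (i : Fin (n + 1) → ℕ)
    (hi : StrictMono i) (a : Fin (n + 1) → ℝ) (ha : ∀ j, a j ≠ 0) :
    (∑ j, monomial (i j) (a j)).natDegree = i (Fin.last n) ∧
    (∑ j, monomial (i j) (a j)).leadingCoeff = a (Fin.last n) ∧
    (∑ j, monomial (i j) (a j)).signVariations =
      ∑ j : Fin n, if a j.castSucc * a j.succ < 0 then 1 else 0 := by
  induction n with
  | zero => simp [natDegree_monomial, ha]
  | succ n ih =>
    obtain ⟨hdeg, hlead, hvar⟩ := ih (fun j => i j.castSucc)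
      (fun x y h => hi (Fin.castSucc_lt_castSucc_iff.2 h))
      (fun j => a j.castSucc) (fun j => ha _)
    rw [Fin.sum_univ_castSucc]
    set Q : ℝ[X] := ∑ j : Fin (n + 1), monomial (i j.castSucc) (a j.castSucc)
    have hlt : Q.degree < (monomial (i (Fin.last (n + 1))) (a (Fin.last (n + 1)))).degree := by
      rw [degree_monomial _ (ha _)]
      refine degree_le_natDegree.trans_lt ?_
      rw [hdeg]
      exact_mod_cast hi (Fin.castSucc_lt_last _)
    have hL : (Q + monomial (i (Fin.last (n + 1))) (a (Fin.last (n + 1)))).leadingCoeff =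
        a (Fin.last (n + 1)) := by
      rw [leadingCoeff_add_of_degree_lt hlt, leadingCoeff_monomial]
    refine ⟨?_, hL, ?_⟩
    · rw [natDegree_add_eq_right_of_degree_lt hlt, natDegree_monomial_eq _ (ha _)]
    · have hne : Q + monomial (i (Fin.last (n + 1))) (a (Fin.last (n + 1))) ≠ 0 := by
        rw [← leadingCoeff_ne_zero, hL]
        exact ha _
      have herase : (Q + monomial (i (Fin.last (n + 1))) (a (Fin.last (n + 1)))).eraseLead = Q := by
        rw [eraseLead_add_of_degree_lt_right hlt, eraseLead_monomial, add_zero]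
      rw [signVariations_eq_eraseLead_add_ite hne, herase, hL, hlead, hvar, Fin.sum_univ_castSucc]
      simp only [Fin.succ_castSucc, Fin.succ_last]
      congr 1
      rcases (ha (Fin.last (n + 1))).lt_or_gt with h | h <;>
      rcases (ha (Fin.last n).castSucc).lt_or_gt with h' | h' <;>
      simp [h, h', mul_neg_iff, h.not_gt, h'.not_gt]

open Classical in
theorem descartes_rule_of_signs (r : ℕ) (hr : 1 < r) (i : Fin r → ℕ) (hi : StrictMono i)
    (a : Fin r → ℝ) (ha : ∀ j, a j ≠ 0) (v : ℕ)
    (hv : v = (Finset.univ.filter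
      (fun j : Fin r => ∃ h : (j : ℕ) + 1 < r, a j * a ⟨(j : ℕ) + 1, h⟩ < 0)).card) :
    ∀ S : Finset ℝ,
      (∀ x ∈ S, 0 < x ∧ ∑ j, a j * x ^ (i j) = 0) → S.card ≤ v := by
  intro S hS
  obtain ⟨n, rfl⟩ : ∃ n, r = n + 1 := ⟨r - 1, by omega⟩
  obtain ⟨-, hlead, hvar⟩ := leadingTerm_and_signVariations_sum_monomial n i hi a ha
  set P : Polynomial ℝ := ∑ j, Polynomial.monomial (i j) (a j) with hP
  have hP0 : P ≠ 0 := by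
    rw [← Polynomial.leadingCoeff_ne_zero, hlead]
    exact ha _
  have hv' : v = P.signVariations := by
    rw [hv, hvar, Finset.card_filter, Fin.sum_univ_castSucc]
    simp [Fin.succ, Fin.castSucc, Fin.castAdd, Fin.castLE]
  rw [hv']
  refine le_trans ?_ P.roots_countP_pos_le_signVariations
  rw [Multiset.countP_eq_card_filter]
  refine Multiset.card_le_card ((Multiset.le_iff_subset S.nodup).2 fun x hx => ?_)
  obtain ⟨hx0, hx1⟩ := hS x hx
  rw [Multiset.mem_filter, Polynomial.mem_roots hP0]
  refine ⟨?_, hx0⟩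
  simpa [hP, Polynomial.IsRoot, Polynomial.eval_finsetSum] using hx1
end

section
/- Given any natural numbers 0 ≤ i_1 < i_2 < … < i_r with r > 1, there exist nonzero real coefficients a_{i_1}, …, a_{i_r} such that the polynomial p(x) = a_{i_1} x^{i_1} + … + a_{i_r} x^{i_r} has exactly r − 1 distinct positive real roots. -/
open Finset

/-- The number of sign variations of a nonzero polynomial is less than its number of terms. -/
theorem Polynomial.signVariations_lt_card_support {P : Polynomial ℝ} (hP : P ≠ 0) :
    P.signVariations < P.support.card := by
  induction hn : P.support.card generalizing P with
  | zero => simp_all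
  | succ n ih =>
    have hcard : P.eraseLead.support.card = n := Polynomial.card_support_eraseLead' hn
    by_cases h0 : P.eraseLead = 0
    · have := P.signVariations_eq_eraseLead_add_ite hP
      simp_all
    · have := ih h0 hcard
      have := P.signVariations_le_eraseLead_succ
      omega

/-- A nonzero real polynomial has fewer distinct positive roots than terms. -/
theorem Polynomial.card_pos_roots_lt_card_support {P : Polynomial ℝ} (hP : P ≠ 0) :
    (P.roots.toFinset.filter (0 < ·)).card < P.support.card := by
  refine lt_of_le_of_lt ?_ (Polynomial.signVariations_lt_card_support hP)
  refine le_trans ?_ P.roots_countP_pos_le_signVariations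
  rw [Multiset.countP_eq_card_filter, ← Multiset.toFinset_filter]
  exact Multiset.toFinset_card_le _

theorem descartes_sharpness (r : ℕ) (hr : 1 < r) (i : Fin r → ℕ) (hi : StrictMono i) :
    ∃ a : Fin r → ℝ, (∀ j, a j ≠ 0) ∧
      ∃ S : Finset ℝ, S.card = r - 1 ∧
        ∀ x : ℝ, (0 < x ∧ ∑ j, a j * x ^ (i j) = 0) ↔ x ∈ S := by
  let M : Matrix (Fin (r - 1)) (Fin r) ℝ := Matrix.of fun k j => ((k : ℝ) + 1) ^ i j
  have hker : M.mulVecLin.ker ≠ ⊥ :=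
    LinearMap.ker_ne_bot_of_finrank_lt (by simp; omega)
  obtain ⟨a, ha, ha0⟩ := Submodule.exists_mem_ne_zero_of_ne_bot hker
  have hroot (k : Fin (r - 1)) : ∑ j, a j * ((k : ℝ) + 1) ^ i j = 0 := by
    have := congrFun (LinearMap.mem_ker.mp ha) k
    simpa [M, Matrix.mulVec, dotProduct, mul_comm] using this
  let P : Polynomial ℝ := ∑ j, Polynomial.monomial (i j) (a j)
  have heval (x : ℝ) : P.eval x = ∑ j, a j * x ^ i j := by
    simp [P, Polynomial.eval_finsetSum]
  have hcoeff (j : Fin r) : P.coeff (i j) = a j := by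
    simp [P, Polynomial.finsetSum_coeff, Polynomial.coeff_monomial, hi.injective.eq_iff]
  have hP : P ≠ 0 := by
    rintro h
    exact ha0 (funext fun j => by simp [← hcoeff j, h])
  have hsupp : P.support.card ≤ (univ.filter fun j => a j ≠ 0).card := by
    refine (card_le_card ?_).trans (card_image_le (f := i))
    intro n hn
    obtain ⟨j, -, hj⟩ := exists_ne_zero_of_sum_ne_zero (by
      simpa [P, Polynomial.finsetSum_coeff] using hn :
        ∑ j, (Polynomial.monomial (i j) (a j)).coeff n ≠ 0)
    rw [Polynomial.coeff_monomial] at hj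
    simp only [mem_image, mem_filter, mem_univ, true_and]
    exact ⟨j, by grind⟩
  have hmem (x : ℝ) : (0 < x ∧ ∑ j, a j * x ^ i j = 0) ↔
      x ∈ P.roots.toFinset.filter (0 < ·) := by
    simp [hP, heval, and_comm]
  have hlower : r - 1 ≤ (P.roots.toFinset.filter (0 < ·)).card := by
    have hinj : Function.Injective fun k : Fin (r - 1) => (k : ℝ) + 1 := fun k l h => by
      simpa [Fin.ext_iff] using h
    rw [← Fintype.card_fin (r - 1), ← card_univ, ← card_image_of_injective _ hinj]
    refine card_le_card fun x hx => ?_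
    obtain ⟨k, -, rfl⟩ := mem_image.mp hx
    exact (hmem _).mp ⟨by positivity, hroot k⟩
  have hupper := Polynomial.card_pos_roots_lt_card_support hP
  have hle : (univ.filter fun j => a j ≠ 0).card ≤ r := by
    simpa using card_filter_le (univ : Finset (Fin r)) fun j => a j ≠ 0
  refine ⟨a, fun j => ?_, _, by omega, hmem⟩
  have hall : (univ.filter fun j => a j ≠ 0) = univ :=
    eq_univ_of_card _ (by rw [Fintype.card_fin]; omega)
  simpa using hall.ge (mem_univ j)
end
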